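/- Every finite-dimensional representation of the equioriented A_n quiver 1 → 2 → ⋯ → n over a field K is isomorphic to a direct sum of interval representations I[b,d] with 1 ≤ b ≤ d ≤ n, and the multiplicities m_{bd} in such a decomposition are uniquely determined. -/

import Mathlib

open Classical

/-- A `K`-linear representation of the equioriented quiver
`A_n : 1 → 2 → ⋯ → n` (vertices indexed by `Fin n`, vertex `i : Fin n`
corresponding to the number `i+1`). -/
structure AnRep (K : Type) [Field K] (n : ℕ) where
  V : Fin n → Type
  [acg : ∀ i, AddCommGroup (V i)]
  [mod : ∀ i, Module K (V i)]
  f : ∀ (i : ℕ) (h : i + 1 < n), V ⟨i, Nat.lt_of_succ_lt h⟩ →ₗ[K] V ⟨i + 1, h⟩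

attribute [instance] AnRep.acg AnRep.mod

variable {K : Type} [Field K] {n : ℕ}

/-- A family of submodules is a subrepresentation if it is closed under the
structure maps. -/
def IsSubrep (M : AnRep K n) (U : ∀ i, Submodule K (M.V i)) : Prop :=
  ∀ (i : ℕ) (h : i + 1 < n),
    Submodule.map (M.f i h) (U ⟨i, Nat.lt_of_succ_lt h⟩) ≤ U ⟨i + 1, h⟩

/-- A representation is indecomposable if it is nonzero and does not decompose as a
direct sum of two nonzero subrepresentations. -/
def AnRep.Indecomposable (M : AnRep K n) : Prop :=
  (∃ i, ∃ x : M.V i, x ≠ 0) ∧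
    ∀ U W : ∀ i, Submodule K (M.V i), IsSubrep M U → IsSubrep M W →
      (∀ i, IsCompl (U i) (W i)) →
      (∀ i, U i = ⊥) ∨ (∀ i, W i = ⊥)

/-- The canonical map between two submodules of `K`: the inclusion (identity) when the
source is contained in the target, and the zero map otherwise. -/
noncomputable def step (S T : Submodule K K) : S →ₗ[K] T :=
  if h : S ≤ T then Submodule.inclusion h else 0

/-- The vertex spaces of the interval representation `I[b,d]`: `K` (as `⊤ ⊆ K`) at
vertices `i` with `b ≤ i ≤ d` (in the numbering `1,…,n`) and `0` otherwise. -/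
def intervalSub (b d : ℕ) (i : Fin n) : Submodule K K :=
  if b ≤ i.1 + 1 ∧ i.1 + 1 ≤ d then ⊤ else ⊥

/-- The interval representation `I[b,d]`: `K` at vertices `b ≤ i ≤ d`, zero elsewhere,
with identity maps between adjacent copies of `K` and zero maps otherwise. -/
noncomputable def interval (K : Type) [Field K] (n b d : ℕ) : AnRep K n where
  V i := intervalSub (K := K) (n := n) b d i
  acg := fun _ => inferInstance
  mod := fun _ => inferInstance
  f i h := step _ _


/-- An isomorphism of representations of the equioriented quiver `A_n`. -/
structure AnIso (M N : AnRep K n) where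
  e : ∀ i, M.V i ≃ₗ[K] N.V i
  comm : ∀ (i : ℕ) (h : i + 1 < n) (x : M.V ⟨i, Nat.lt_of_succ_lt h⟩),
    e ⟨i + 1, h⟩ (M.f i h x) = N.f i h (e ⟨i, Nat.lt_of_succ_lt h⟩ x)

/-- A subrepresentation, viewed as a representation in its own right. -/
def subrep (M : AnRep K n) (U : ∀ i, Submodule K (M.V i)) (hU : IsSubrep M U) :
    AnRep K n where
  V i := U i
  acg := fun _ => inferInstance
  mod := fun _ => inferInstance
  f i h := (M.f i h).restrict fun x hx => hU i h (Submodule.mem_map_of_mem hx)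

/-- The composite of the structure maps from vertex `a` to vertex `j`, extended by zero to
the vertices `j` before `a`. -/
noncomputable def AnRep.transport (M : AnRep K n) (a : Fin n) :
    ∀ (j : ℕ) (hj : j < n), M.V a →ₗ[K] M.V ⟨j, hj⟩
  | 0, hj => if h : a = ⟨0, hj⟩ then h ▸ LinearMap.id else 0
  | j + 1, hj =>
      if h : a = ⟨j + 1, hj⟩ then h ▸ LinearMap.id
      else M.f j hj ∘ₗ AnRep.transport M a j (Nat.lt_of_succ_lt hj)

namespace AnRep

variable (M : AnRep K n)

theorem transport_self (a : ℕ) (ha : a < n) :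
    M.transport ⟨a, ha⟩ a ha = LinearMap.id := by
  cases a <;> simp [transport]

theorem transport_of_lt (a : Fin n) (j : ℕ) (hj : j < n) (h : j < a.1) :
    M.transport a j hj = 0 := by
  induction j with
  | zero =>
    have : a ≠ ⟨0, hj⟩ := fun e => by simp [e] at h
    simp [transport, this]
  | succ j ih =>
    have : a ≠ ⟨j + 1, hj⟩ := fun e => by simp [e] at h
    simp [transport, this, ih _ (Nat.lt_of_succ_lt h)]

theorem transport_succ (a : Fin n) (j : ℕ) (hj : j + 1 < n) (h : a.1 ≤ j) :
    M.transport a (j + 1) hj = M.f j hj ∘ₗ M.transport a j (Nat.lt_of_succ_lt hj) := by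
  have : a ≠ ⟨j + 1, hj⟩ := fun e => by simp [e] at h
  simp [transport, this]

theorem transport_comp (a b : Fin n) (hab : a.1 ≤ b.1) (c : ℕ) (hc : c < n) (hbc : b.1 ≤ c) :
    M.transport b c hc ∘ₗ M.transport a b.1 b.2 = M.transport a c hc := by
  induction c, hbc using Nat.le_induction with
  | base => rw [M.transport_self b.1 b.2, LinearMap.id_comp]
  | succ c hbc ih =>
    rw [transport_succ _ _ _ _ hbc, transport_succ _ _ _ _ (hab.trans hbc), LinearMap.comp_assoc,
      ih]

theorem transport_comp_apply (a b : Fin n) (hab : a.1 ≤ b.1) (c : ℕ) (hc : c < n)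
    (hbc : b.1 ≤ c) (x : M.V a) :
    M.transport b c hc (M.transport a b.1 b.2 x) = M.transport a c hc x :=
  LinearMap.congr_fun (M.transport_comp a b hab c hc hbc) x

theorem transport_comp_f (a : ℕ) (ha : a + 1 < n) (c : ℕ) (hc : c < n) (hac : a < c)
    (x : M.V ⟨a, Nat.lt_of_succ_lt ha⟩) :
    M.transport ⟨a + 1, ha⟩ c hc (M.f a ha x) =
      M.transport ⟨a, Nat.lt_of_succ_lt ha⟩ c hc x := by
  rw [← M.transport_comp_apply ⟨a, _⟩ ⟨a + 1, ha⟩ (Nat.le_succ a) c hc hac,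
    transport_succ _ _ _ _ le_rfl, transport_self]
  rfl

end AnRep

theorem IsSubrep.transport_mem {M : AnRep K n} {U : ∀ i, Submodule K (M.V i)}
    (hU : IsSubrep M U) (a : Fin n) {x : M.V a} (hx : x ∈ U a) (j : ℕ) (hj : j < n) :
    M.transport a j hj x ∈ U ⟨j, hj⟩ := by
  rcases lt_or_ge j a.1 with h | h
  · simp [M.transport_of_lt a j hj h]
  · induction j, h using Nat.le_induction with
    | base => rw [M.transport_self a.1 a.2]; exact hx
    | succ j h ih =>
      rw [M.transport_succ _ _ _ h]
      exact hU j hj (Submodule.mem_map_of_mem (ih _))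

theorem intervalSub_eq_top {b d : ℕ} {i : Fin n} (h : b ≤ i.1 + 1 ∧ i.1 + 1 ≤ d) :
    intervalSub (K := K) b d i = ⊤ :=
  if_pos h

theorem intervalSub_eq_zero {b d : ℕ} {i : Fin n} (h : ¬(b ≤ i.1 + 1 ∧ i.1 + 1 ≤ d))
    (c : intervalSub (K := K) b d i) : c = 0 := by
  have hbot : intervalSub (K := K) b d i = ⊥ := if_neg h
  exact Subtype.ext ((Submodule.mem_bot K).1 (hbot.le c.2))

/-- Vectors `v i` spanning `U i` that exhibit `U` as a copy of the interval representation
`I[b,d]`. -/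
structure IsIntervalBasis (M : AnRep K n) (U : ∀ i, Submodule K (M.V i)) (b d : ℕ)
    (v : ∀ i, M.V i) : Prop where
  span : ∀ i, U i = K ∙ v i
  ne_zero_iff : ∀ i, v i ≠ 0 ↔ b ≤ i.1 + 1 ∧ i.1 + 1 ≤ d
  map : ∀ (i : ℕ) (h : i + 1 < n), b ≤ i + 1 →
    M.f i h (v ⟨i, Nat.lt_of_succ_lt h⟩) = v ⟨i + 1, h⟩

namespace IsIntervalBasis

variable {M : AnRep K n} {U : ∀ i, Submodule K (M.V i)} {b d : ℕ} {v : ∀ i, M.V i}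

theorem mem (hv : IsIntervalBasis M U b d v) (i : Fin n) : v i ∈ U i := by
  rw [hv.span]
  exact Submodule.mem_span_singleton_self _

theorem isSubrep (hv : IsIntervalBasis M U b d v) : IsSubrep M U := by
  intro i h
  rw [hv.span, Submodule.map_span, Set.image_singleton, Submodule.span_singleton_le_iff_mem]
  by_cases hb : b ≤ i + 1
  · rw [hv.map i h hb]
    exact hv.mem _
  · have : v ⟨i, Nat.lt_of_succ_lt h⟩ = 0 := by
      by_contra h0
      exact hb ((hv.ne_zero_iff _).1 h0).1
    simp [this]

/-- The linear map from the interval representation to `U` sending `1` to `v i`. -/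
noncomputable def toSubrep (hv : IsIntervalBasis M U b d v) (i : Fin n) :
    intervalSub (K := K) b d i →ₗ[K] U i :=
  ((LinearMap.toSpanSingleton K (M.V i) (v i)).codRestrict (U i) fun c =>
    (U i).smul_mem c (hv.mem i)) ∘ₗ (intervalSub b d i).subtype

theorem coe_toSubrep (hv : IsIntervalBasis M U b d v) (i : Fin n)
    (c : intervalSub (K := K) b d i) : (hv.toSubrep i c : M.V i) = (c : K) • v i := rfl

theorem toSubrep_bijective (hv : IsIntervalBasis M U b d v) (i : Fin n) :
    Function.Bijective (hv.toSubrep i) := by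
  constructor
  · rw [injective_iff_map_eq_zero]
    intro c hc
    have hc' : (c : K) • v i = 0 := congrArg Subtype.val hc
    rcases smul_eq_zero.1 hc' with h | h
    · exact Subtype.ext h
    · exact intervalSub_eq_zero (mt (hv.ne_zero_iff i).2 (not_not.2 h)) c
  · rintro ⟨x, hx⟩
    have hx' := hx
    rw [hv.span, Submodule.mem_span_singleton] at hx'
    obtain ⟨c, rfl⟩ := hx'
    by_cases hbd : b ≤ i.1 + 1 ∧ i.1 + 1 ≤ d
    · exact ⟨⟨c, (intervalSub_eq_top hbd).ge Submodule.mem_top⟩, rfl⟩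
    · refine ⟨0, Subtype.ext ?_⟩
      simp [not_not.1 (mt (hv.ne_zero_iff i).1 hbd)]

theorem toSubrep_step (hv : IsIntervalBasis M U b d v) (i : ℕ) (h : i + 1 < n)
    (c : intervalSub (K := K) b d ⟨i, Nat.lt_of_succ_lt h⟩) :
    M.f i h ((hv.toSubrep _ c : U _) : M.V _) =
      (hv.toSubrep ⟨i + 1, h⟩ (step _ _ c) : M.V _) := by
  rw [coe_toSubrep, coe_toSubrep, map_smul]
  by_cases hi : b ≤ i + 1 ∧ i + 1 ≤ d
  · rw [hv.map i h hi.1]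
    by_cases hle : intervalSub (K := K) b d ⟨i, Nat.lt_of_succ_lt h⟩ ≤
        intervalSub (K := K) b d ⟨i + 1, h⟩
    · simp [step, hle]
    · have h0 : v ⟨i + 1, h⟩ = 0 := by
        by_contra h0
        exact hle (le_of_le_of_eq le_top
          (intervalSub_eq_top ((hv.ne_zero_iff _).1 h0)).symm)
      simp [h0]
  · simp [intervalSub_eq_zero hi c]

theorem nonempty_anIso (hv : IsIntervalBasis M U b d v) :
    Nonempty (AnIso (subrep M U hv.isSubrep) (interval K n b d)) :=
  ⟨{ e := fun i => (LinearEquiv.ofBijective (hv.toSubrep i) (hv.toSubrep_bijective i)).symm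
     comm := fun i h x => by
      obtain ⟨c, rfl⟩ := (hv.toSubrep_bijective ⟨i, Nat.lt_of_succ_lt h⟩).2 x
      refine (LinearEquiv.symm_apply_eq (LinearEquiv.ofBijective (hv.toSubrep _)
        (hv.toSubrep_bijective _))).2 ?_
      have hc : (LinearEquiv.ofBijective (hv.toSubrep ⟨i, Nat.lt_of_succ_lt h⟩)
          (hv.toSubrep_bijective _)).symm (hv.toSubrep _ c) = c :=
        LinearEquiv.ofBijective_symm_apply_apply _ c
      exact Subtype.ext ((hv.toSubrep_step i h c).trans (congrArg
        (fun z : intervalSub (K := K) b d ⟨i, Nat.lt_of_succ_lt h⟩ =>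
          (hv.toSubrep ⟨i + 1, h⟩ (step _ _ z) : M.V ⟨i + 1, h⟩)) hc.symm)) }⟩

theorem transport_apply (hv : IsIntervalBasis M U b d v) (a : Fin n) (hb : b ≤ a.1 + 1)
    (c : ℕ) (hc : c < n) (hac : a.1 ≤ c) : M.transport a c hc (v a) = v ⟨c, hc⟩ := by
  induction c, hac using Nat.le_induction with
  | base => rw [M.transport_self a.1 a.2]; rfl
  | succ c hac ih =>
    rw [M.transport_succ _ _ _ hac, LinearMap.comp_apply, ih, hv.map c hc (by omega)]

end IsIntervalBasis

theorem AnIso.exists_isIntervalBasis {M : AnRep K n} {U : ∀ i, Submodule K (M.V i)}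
    {hU : IsSubrep M U} {b d : ℕ} (φ : AnIso (subrep M U hU) (interval K n b d)) :
    ∃ v, IsIntervalBasis M U b d v := by
  have hone : ∀ i : Fin n, (if b ≤ i.1 + 1 ∧ i.1 + 1 ≤ d then (1 : K) else 0) ∈
      intervalSub (K := K) b d i := fun i => by
    split_ifs with h
    · exact (intervalSub_eq_top h).ge Submodule.mem_top
    · exact Submodule.zero_mem _
  let c : ∀ i : Fin n, intervalSub (K := K) b d i := fun i => ⟨_, hone i⟩
  let w : ∀ i : Fin n, U i := fun i => (φ.e i).symm (c i)
  have hew : ∀ i, φ.e i (w i) = c i := fun i => (φ.e i).apply_symm_apply (c i)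
  refine ⟨fun i => w i, fun i => le_antisymm ?_ ?_, fun i => ?_, fun i h hb => ?_⟩
  · intro x hx
    rw [Submodule.mem_span_singleton]
    let y : intervalSub (K := K) b d i := φ.e i ⟨x, hx⟩
    have hy : (y : K) • c i = y := by
      by_cases hbd : b ≤ i.1 + 1 ∧ i.1 + 1 ≤ d
      · exact Subtype.ext ((congrArg (y.1 * ·) (if_pos hbd)).trans (mul_one _))
      · exact (intervalSub_eq_zero hbd _).trans (intervalSub_eq_zero hbd _).symm
    refine ⟨y, ?_⟩
    have h1 : (y : K) • w i = ⟨x, hx⟩ := by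
      apply (φ.e i).injective
      refine ((φ.e i).map_smul _ _).trans ?_
      rw [hew]
      exact hy
    exact congrArg Subtype.val h1
  · rw [Submodule.span_singleton_le_iff_mem]
    exact (w i).2
  · have h1 : (w i : M.V i) = 0 ↔ c i = 0 := by
      rw [Submodule.coe_eq_zero]
      exact (φ.e i).symm.map_eq_zero_iff
    rw [Ne, h1, ← Submodule.coe_eq_zero]
    simp [c]
  · have h1 : (subrep M U hU).f i h (w _) = w ⟨i + 1, h⟩ := by
      apply (φ.e _).injective
      rw [φ.comm, hew, hew]
      change step _ _ (c _) = c _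
      by_cases hi : i + 1 + 1 ≤ d
      · have hle : intervalSub (K := K) b d ⟨i, Nat.lt_of_succ_lt h⟩ ≤
            intervalSub (K := K) b d ⟨i + 1, h⟩ :=
          le_of_le_of_eq le_top (intervalSub_eq_top ⟨Nat.le_succ_of_le hb, hi⟩).symm
        rw [step, dif_pos hle]
        exact Subtype.ext ((if_pos ⟨hb, Nat.le_of_succ_le hi⟩).trans
          (if_pos ⟨Nat.le_succ_of_le hb, hi⟩).symm)
      · have hi' : ¬(b ≤ i + 1 + 1 ∧ i + 1 + 1 ≤ d) := fun hh => hi hh.2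
        exact (intervalSub_eq_zero hi' _).trans (intervalSub_eq_zero hi' _).symm
    exact congrArg Subtype.val h1

/-- Every nonzero subrepresentation `W` contains a copy of an interval representation with a
complement in `W`. -/
theorem IsSubrep.exists_interval_summand {M : AnRep K n} {W : ∀ i, Submodule K (M.V i)}
    (hW : IsSubrep M W) (hne : ∃ i, W i ≠ ⊥) :
    ∃ (b d : ℕ) (v : ∀ i, M.V i) (W' : ∀ i, Submodule K (M.V i)),
      1 ≤ b ∧ b ≤ d ∧ d ≤ n ∧ IsIntervalBasis M (fun i => K ∙ v i) b d v ∧ IsSubrep M W' ∧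
        (∀ i, Disjoint (K ∙ v i) (W' i)) ∧ (∀ i, (K ∙ v i) ⊔ W' i = W i) ∧
        ∃ i, W' i < W i := by
  obtain ⟨a, ha, hmin⟩ : ∃ a, W a ≠ ⊥ ∧ ∀ i < a, W i = ⊥ := by
    obtain ⟨a, ha, hmin⟩ := WellFounded.has_min (wellFounded_lt (α := Fin n)) {i | W i ≠ ⊥} hne
    exact ⟨a, ha, fun i hi => by_contra fun h => hmin i h hi⟩
  obtain ⟨x, hxW, hx⟩ := Submodule.exists_mem_ne_zero_of_ne_bot ha
  let v : ∀ i, M.V i := fun i => M.transport a i.1 i.2 x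
  have hva : v a = x := by
    change M.transport a a.1 a.2 x = x
    rw [M.transport_self a.1 a.2]; rfl
  have hv_lt : ∀ i < a, v i = 0 := fun i hi => by
    simp only [v]; rw [M.transport_of_lt a _ _ hi]; rfl
  have hv_tr : ∀ i j : Fin n, a ≤ i → i ≤ j → M.transport i j.1 j.2 (v i) = v j :=
    fun i j hi hj => M.transport_comp_apply a i hi j.1 j.2 hj x
  obtain ⟨e, hve, hmax⟩ : ∃ e, v e ≠ 0 ∧ ∀ i, e < i → v i = 0 := by
    obtain ⟨e, he, hmax⟩ := WellFounded.has_min (wellFounded_gt (α := Fin n))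
      {i | v i ≠ 0} ⟨a, by simpa [hva] using hx⟩
    exact ⟨e, he, fun i hi => by_contra fun h => hmax i h hi⟩
  have hae : a ≤ e := not_lt.1 fun h => hve (hv_lt e h)
  obtain ⟨ψ, hψ⟩ := Module.Projective.exists_dual_eq_one K hve
  have hvW : ∀ i, v i ∈ W i := fun i => hW.transport_mem a hxW i.1 i.2
  have hψv : ∀ i, a ≤ i → i ≤ e → ψ (M.transport i e.1 e.2 (v i)) = 1 := fun i hi hi' => by
    rw [hv_tr i e hi hi']; exact hψ
  have hbasis : IsIntervalBasis M (fun i => K ∙ v i) (a.1 + 1) (e.1 + 1) v := by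
    refine ⟨fun i => rfl, fun i => ⟨fun h => ⟨?_, ?_⟩, fun h h0 => ?_⟩, fun i h hi => ?_⟩
    · exact Nat.succ_le_succ (not_lt.1 fun hlt => h (hv_lt i hlt))
    · exact Nat.succ_le_succ (not_lt.1 fun hlt => h (hmax i hlt))
    · apply hve
      rw [← hv_tr i e (Nat.le_of_succ_le_succ h.1) (Nat.le_of_succ_le_succ h.2), h0, map_zero]
    · exact (LinearMap.congr_fun (M.transport_succ a i h (Nat.le_of_succ_le_succ hi)) x).symm
  let W' : ∀ i, Submodule K (M.V i) := fun i => W i ⊓ LinearMap.ker (ψ ∘ₗ M.transport i e.1 e.2)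
  have hdisj : ∀ i, Disjoint (K ∙ v i) (W' i) := fun i => by
    rw [Submodule.disjoint_def]
    intro y hy hy'
    obtain ⟨c, rfl⟩ := Submodule.mem_span_singleton.1 hy
    by_cases h : v i = 0
    · simp [h]
    have hbd := (hbasis.ne_zero_iff i).1 h
    have hk : ψ (M.transport i e.1 e.2 (c • v i)) = 0 := hy'.2
    rw [map_smul, map_smul,
      hψv i (Nat.le_of_succ_le_succ hbd.1) (Nat.le_of_succ_le_succ hbd.2)] at hk
    have : c = 0 := by simpa using hk
    simp [this]
  refine ⟨a.1 + 1, e.1 + 1, v, W', by omega, Nat.succ_le_succ hae, e.2, hbasis, ?_, hdisj,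
    fun i => le_antisymm ?_ ?_, a, ?_⟩
  · intro i h
    rw [Submodule.map_le_iff_le_comap]
    rintro y ⟨hyW, hyk⟩
    refine ⟨hW i h (Submodule.mem_map_of_mem hyW), ?_⟩
    have hyk' : ψ (M.transport ⟨i, Nat.lt_of_succ_lt h⟩ e.1 e.2 y) = 0 := hyk
    change ψ (M.transport ⟨i + 1, h⟩ e.1 e.2 (M.f i h y)) = 0
    rcases Nat.lt_or_ge i e.1 with hi | hi
    · rw [M.transport_comp_f i h e.1 e.2 hi, hyk']
    · rw [M.transport_of_lt ⟨i + 1, h⟩ e.1 e.2 (Nat.lt_succ_of_le hi)]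
      simp
  · exact sup_le ((Submodule.span_singleton_le_iff_mem _ _).2 (hvW i)) inf_le_left
  · intro y hy
    rw [Submodule.mem_sup]
    refine ⟨ψ (M.transport i e.1 e.2 y) • v i, Submodule.mem_span_singleton.2 ⟨_, rfl⟩,
      y - ψ (M.transport i e.1 e.2 y) • v i,
      ⟨(W i).sub_mem hy ((W i).smul_mem _ (hvW i)), ?_⟩, by abel⟩
    change ψ (M.transport i e.1 e.2 (y - ψ (M.transport i e.1 e.2 y) • v i)) = 0
    rw [map_sub, map_sub, map_smul, map_smul]
    rcases lt_or_ge i a with hi | hi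
    · have : y = 0 := by simpa [hmin i hi] using hy
      simp [this]
    rcases lt_or_ge e i with hi' | hi'
    · rw [M.transport_of_lt i e.1 e.2 hi']
      simp
    · rw [hψv i hi hi']
      simp
  · refine lt_of_le_of_ne inf_le_left fun h => hx ?_
    have hmem : x ∈ W' a := h ▸ hxW
    exact (Submodule.disjoint_def.1 (hdisj a)) x
      (Submodule.mem_span_singleton.2 ⟨1, by rw [hva, one_smul]⟩) hmem

theorem iSupIndep_fin_cons {α : Type*} [CompleteLattice α] [IsModularLattice α] {s : ℕ}
    {a : α} {u : Fin s → α} (hu : iSupIndep u) (ha : Disjoint a (⨆ j, u j)) :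
    iSupIndep (Fin.cons a u : Fin (s + 1) → α) := by
  rw [iSupIndep_iff_supIndep_univ] at hu ⊢
  rw [Fin.univ_succ, Finset.cons_eq_insert]
  refine Finset.SupIndep.insert ?_ ?_
  · rw [Finset.supIndep_map]
    exact hu
  · rw [Finset.sup_map, Finset.sup_univ_eq_iSup]
    exact ha

theorem IsSubrep.exists_interval_decomposition {M : AnRep K n}
    (fd : ∀ i, FiniteDimensional K (M.V i)) {W : ∀ i, Submodule K (M.V i)}
    (hW : IsSubrep M W) :
    ∃ (s : ℕ) (U : Fin s → ∀ i, Submodule K (M.V i)) (bd : Fin s → ℕ × ℕ),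
      (∀ i, iSupIndep fun j => U j i) ∧ (∀ i, ⨆ j, U j i = W i) ∧
        ∀ j, 1 ≤ (bd j).1 ∧ (bd j).1 ≤ (bd j).2 ∧ (bd j).2 ≤ n ∧
          ∃ v, IsIntervalBasis M (U j) (bd j).1 (bd j).2 v := by
  induction hm : ∑ i, Module.finrank K (W i) using Nat.strong_induction_on generalizing W with
  | _ m ih =>
  by_cases hne : ∃ i, W i ≠ ⊥
  · obtain ⟨b, d, v, W', hb, hbd, hd, hv, hW', hdisj, hsup, i₀, hi₀⟩ :=
      hW.exists_interval_summand hne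
    have hlt : ∑ i, Module.finrank K (W' i) < m := by
      rw [← hm]
      refine Finset.sum_lt_sum (fun i _ => Submodule.finrank_mono ?_)
        ⟨i₀, Finset.mem_univ _, Submodule.finrank_lt_finrank_of_lt hi₀⟩
      rw [← hsup i]
      exact le_sup_right
    obtain ⟨s, U, bd, hind, hsup', hU⟩ := ih _ hlt hW' rfl
    have hcons : ∀ i, (fun j => (Fin.cons (fun i => K ∙ v i) U :
        Fin (s + 1) → ∀ i, Submodule K (M.V i)) j i) =
        (Fin.cons (K ∙ v i) (fun j => U j i) : Fin (s + 1) → Submodule K (M.V i)) := fun i => by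
      funext j
      cases j using Fin.cases <;> rfl
    refine ⟨s + 1, Fin.cons (fun i => K ∙ v i) U, Fin.cons (b, d) bd, fun i => ?_, fun i => ?_,
      fun j => ?_⟩
    · rw [hcons]
      exact iSupIndep_fin_cons (hind i) (by rw [hsup' i]; exact hdisj i)
    · refine Eq.trans ?_ (hsup i)
      rw [← hsup' i]
      refine le_antisymm (iSup_le fun j => ?_) (sup_le ?_ (iSup_le fun j => ?_))
      · cases j using Fin.cases with
        | zero => exact le_sup_left
        | succ j => exact (le_iSup (fun j => U j i) j).trans le_sup_right
      · exact le_iSup (fun j => (Fin.cons (fun i => K ∙ v i) U :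
          Fin (s + 1) → ∀ i, Submodule K (M.V i)) j i) 0
      · exact le_iSup (fun j => (Fin.cons (fun i => K ∙ v i) U :
          Fin (s + 1) → ∀ i, Submodule K (M.V i)) j i) j.succ
    · cases j using Fin.cases with
      | zero => exact ⟨hb, hbd, hd, v, hv⟩
      | succ j => exact hU j
  · push Not at hne
    exact ⟨0, Fin.elim0, Fin.elim0, fun i => iSupIndep_subsingleton _, fun i => by simp [hne],
      fun j => j.elim0⟩

/-- The number of summands `I[b,d]` with `b ≤ a ≤ c ≤ d` is the rank of the map from `a` to `c`. -/
theorem finrank_range_transport {M : AnRep K n} {s : ℕ} {U : Fin s → ∀ i, Submodule K (M.V i)}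
    {bd : Fin s → ℕ × ℕ} {v : Fin s → ∀ i, M.V i}
    (hint : ∀ i, DirectSum.IsInternal fun j => U j i)
    (hv : ∀ j, IsIntervalBasis M (U j) (bd j).1 (bd j).2 (v j))
    (a : Fin n) (c : ℕ) (hc : c < n) (hac : a.1 ≤ c) :
    Module.finrank K (LinearMap.range (M.transport a c hc)) =
      (Finset.univ.filter fun j => (bd j).1 ≤ a.1 + 1 ∧ c + 1 ≤ (bd j).2).card := by
  let S := {j // (bd j).1 ≤ a.1 + 1 ∧ c + 1 ≤ (bd j).2}
  have hli : LinearIndependent K fun j : S => v j.1 ⟨c, hc⟩ := by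
    have hind := ((DirectSum.isInternal_submodule_iff_iSupIndep_and_iSup_eq_top _).1
      (hint ⟨c, hc⟩)).1
    refine (hind.comp (f := fun j : S => j.1) Subtype.val_injective).linearIndependent _
      (fun j => (hv j.1).mem _) fun j => ?_
    exact ((hv j.1).ne_zero_iff _).2 ⟨by have := j.2.1; simp; omega, j.2.2⟩
  have hrange : LinearMap.range (M.transport a c hc) =
      Submodule.span K (Set.range fun j : S => v j.1 ⟨c, hc⟩) := by
    have htop := ((DirectSum.isInternal_submodule_iff_iSupIndep_and_iSup_eq_top _).1
      (hint a)).2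
    rw [LinearMap.range_eq_map, ← htop, Submodule.map_iSup]
    refine le_antisymm (iSup_le fun j => ?_) (Submodule.span_le.2 ?_)
    · rw [(hv j).span a, Submodule.map_span, Set.image_singleton,
        Submodule.span_singleton_le_iff_mem]
      by_cases ha : v j a = 0
      · simp [ha]
      have hb := ((hv j).ne_zero_iff a).1 ha
      rw [(hv j).transport_apply a hb.1 c hc hac]
      by_cases hc0 : v j ⟨c, hc⟩ = 0
      · simp [hc0]
      · exact Submodule.subset_span
          ⟨⟨j, hb.1, (((hv j).ne_zero_iff _).1 hc0).2⟩, rfl⟩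
    · rintro _ ⟨j, rfl⟩
      refine Submodule.mem_iSup_of_mem j.1 ⟨v j.1 a, (hv j.1).mem a, ?_⟩
      exact (hv j.1).transport_apply a j.2.1 c hc hac
  rw [hrange, finrank_span_eq_card hli]
  exact Fintype.card_subtype _

/-- The multiplicity of a pair is determined by the numbers of pairs containing `[a,c]`, by
inclusion-exclusion. -/
theorem card_filter_eq_add {ι : Type*} [Fintype ι] (bd : ι → ℕ × ℕ) (b d : ℕ) (hb : 1 ≤ b) :
    (Finset.univ.filter fun j => bd j = (b, d)).card +
        ((Finset.univ.filter fun j => (bd j).1 ≤ b - 1 ∧ d ≤ (bd j).2).card +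
          (Finset.univ.filter fun j => (bd j).1 ≤ b ∧ d + 1 ≤ (bd j).2).card) =
      (Finset.univ.filter fun j => (bd j).1 ≤ b ∧ d ≤ (bd j).2).card +
        (Finset.univ.filter fun j => (bd j).1 ≤ b - 1 ∧ d + 1 ≤ (bd j).2).card := by
  simp only [Finset.card_filter, ← Finset.sum_add_distrib]
  refine Finset.sum_congr rfl fun j _ => ?_
  simp only [Prod.ext_iff]
  split_ifs <;> omega

theorem card_filter_le_eq {M : AnRep K n} {s t : ℕ} {U : Fin s → ∀ i, Submodule K (M.V i)}
    {U' : Fin t → ∀ i, Submodule K (M.V i)} {bd : Fin s → ℕ × ℕ} {bd' : Fin t → ℕ × ℕ}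
    {v : Fin s → ∀ i, M.V i} {v' : Fin t → ∀ i, M.V i}
    (hint : ∀ i, DirectSum.IsInternal fun j => U j i)
    (hint' : ∀ i, DirectSum.IsInternal fun j => U' j i)
    (hv : ∀ j, IsIntervalBasis M (U j) (bd j).1 (bd j).2 (v j))
    (hv' : ∀ j, IsIntervalBasis M (U' j) (bd' j).1 (bd' j).2 (v' j))
    (hbd : ∀ j, 1 ≤ (bd j).1 ∧ (bd j).2 ≤ n) (hbd' : ∀ j, 1 ≤ (bd' j).1 ∧ (bd' j).2 ≤ n)
    (a c : ℕ) (hac : a ≤ c) :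
    (Finset.univ.filter fun j => (bd j).1 ≤ a ∧ c ≤ (bd j).2).card =
      (Finset.univ.filter fun j => (bd' j).1 ≤ a ∧ c ≤ (bd' j).2).card := by
  by_cases h : 1 ≤ a ∧ c ≤ n
  · obtain ⟨a, rfl⟩ := Nat.exists_eq_add_of_le' h.1
    obtain ⟨c, rfl⟩ := Nat.exists_eq_add_of_le' (h.1.trans hac)
    have hc : c < n := h.2
    have hac' : a ≤ c := Nat.le_of_succ_le_succ hac
    exact (finrank_range_transport hint hv ⟨a, hac'.trans_lt hc⟩ c hc hac').symm.trans
      (finrank_range_transport hint' hv' ⟨a, hac'.trans_lt hc⟩ c hc hac')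
  · rw [Finset.filter_false_of_mem, Finset.filter_false_of_mem, Finset.card_empty,
      Finset.card_empty]
    · intro j _ hj
      have := hbd' j
      omega
    · intro j _ hj
      have := hbd j
      omega

/-- Gabriel's theorem for equioriented `A_n`: every finite-dimensional
representation `M` of `1 → 2 → ⋯ → n` over a field `K` decomposes as an (internal)
direct sum of subrepresentations, each isomorphic to an interval representation
`I[b,d]` with `1 ≤ b ≤ d ≤ n`; moreover the multiplicity of each interval `I[b,d]`
in such a decomposition is uniquely determined. -/
theorem gabriel_An (M : AnRep K n) (fd : ∀ i, FiniteDimensional K (M.V i)) :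
    (∃ (s : ℕ) (U : Fin s → ∀ i, Submodule K (M.V i))
        (hU : ∀ j, IsSubrep M (U j)) (bd : Fin s → ℕ × ℕ),
        (∀ i, DirectSum.IsInternal fun j => U j i) ∧
        (∀ j, 1 ≤ (bd j).1 ∧ (bd j).1 ≤ (bd j).2 ∧ (bd j).2 ≤ n ∧
          Nonempty (AnIso (subrep M (U j) (hU j)) (interval K n (bd j).1 (bd j).2)))) ∧
    (∀ (s t : ℕ) (U : Fin s → ∀ i, Submodule K (M.V i))
        (U' : Fin t → ∀ i, Submodule K (M.V i))
        (hU : ∀ j, IsSubrep M (U j)) (hU' : ∀ j, IsSubrep M (U' j))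
        (bd : Fin s → ℕ × ℕ) (bd' : Fin t → ℕ × ℕ),
        (∀ i, DirectSum.IsInternal fun j => U j i) →
        (∀ j, 1 ≤ (bd j).1 ∧ (bd j).1 ≤ (bd j).2 ∧ (bd j).2 ≤ n ∧
          Nonempty (AnIso (subrep M (U j) (hU j)) (interval K n (bd j).1 (bd j).2))) →
        (∀ i, DirectSum.IsInternal fun j => U' j i) →
        (∀ j, 1 ≤ (bd' j).1 ∧ (bd' j).1 ≤ (bd' j).2 ∧ (bd' j).2 ≤ n ∧
          Nonempty (AnIso (subrep M (U' j) (hU' j)) (interval K n (bd' j).1 (bd' j).2))) →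
        ∀ p : ℕ × ℕ,
          (Finset.univ.filter fun j => bd j = p).card =
            (Finset.univ.filter fun j => bd' j = p).card) := by
  refine ⟨?_, ?_⟩
  · have htop : IsSubrep M fun _ => ⊤ := fun i h => le_top
    obtain ⟨s, U, bd, hind, hsup, hU⟩ := htop.exists_interval_decomposition fd
    choose h1 h2 h3 v hv using hU
    exact ⟨s, U, fun j => (hv j).isSubrep, bd,
      fun i => (DirectSum.isInternal_submodule_iff_iSupIndep_and_iSup_eq_top _).2
        ⟨hind i, hsup i⟩,
      fun j => ⟨h1 j, h2 j, h3 j, (hv j).nonempty_anIso⟩⟩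
  · rintro s t U U' hU hU' bd bd' hint h hint' h' ⟨b, d⟩
    choose v hv using fun j => (h j).2.2.2.some.exists_isIntervalBasis
    choose v' hv' using fun j => (h' j).2.2.2.some.exists_isIntervalBasis
    by_cases hp : 1 ≤ b ∧ b ≤ d
    · have key := card_filter_le_eq hint hint' hv hv' (fun j => ⟨(h j).1, (h j).2.2.1⟩)
        fun j => ⟨(h' j).1, (h' j).2.2.1⟩
      have e := card_filter_eq_add bd b d hp.1
      have e' := card_filter_eq_add bd' b d hp.1
      rw [key b d hp.2, key (b - 1) d (by omega), key b (d + 1) (by omega),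
        key (b - 1) (d + 1) (by omega)] at e
      exact Nat.add_right_cancel (e.trans e'.symm)
    · rw [Finset.filter_false_of_mem, Finset.filter_false_of_mem, Finset.card_empty,
        Finset.card_empty]
      · intro j _ hj
        have := h' j
        rw [hj] at this
        exact hp ⟨this.1, this.2.1⟩
      · intro j _ hj
        have := h j
        rw [hj] at this
        exact hp ⟨this.1, this.2.1⟩
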